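/- arXiv:math/9904099 — 2 statements merged into one kernel-verified Lean document; each statement's English description precedes it below -/
import Mathlib

section
/- There exist a finite sequence of positive and negative braid moves carrying the inverse matrix (S_upper)⁻¹ to a matrix S″ and a diagonal matrix D with all diagonal entries in {1, −1} such that D·S″·D = C_k. -/
open Matrix Complex

/-- The matrix `T_F`: `(T_F)_{1,k} = 1`, `(T_F)_{j+1,j} = -1`, all other entries `0`
(1-based indexing). -/
def TFmat (k : ℕ) : Matrix (Fin k) (Fin k) ℂ :=
  Matrix.of fun i j => if i.val = 0 ∧ j.val = k - 1 then 1
    else if i.val = j.val + 1 then -1 else 0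

/-- The Stokes factor `K_{k2}`: identity except `(K_{k2})_{j,k+2-j} = C(k, 2(j-1))`
for `2 ≤ j`, `2j ≤ k+1` (1-based indexing). -/
def Kk2mat (k : ℕ) : Matrix (Fin k) (Fin k) ℂ :=
  Matrix.of fun i j =>
    if 2 ≤ i.val + 1 ∧ 2 * (i.val + 1) ≤ k + 1 ∧ (j.val + 1) + (i.val + 1) = k + 2 then
      (k.choose (2 * i.val) : ℂ)
    else if i = j then 1 else 0

/-- The Stokes factor `K_{k3}`: identity except `(K_{k3})_{2,1} = -k` and
`(K_{k3})_{j,k+3-j} = C(k, 2j-3)` for `3 ≤ j`, `2j ≤ k+2` (1-based indexing). -/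
def Kk3mat (k : ℕ) : Matrix (Fin k) (Fin k) ℂ :=
  Matrix.of fun i j =>
    if i.val + 1 = 2 ∧ j.val + 1 = 1 then -(k : ℂ)
    else if 3 ≤ i.val + 1 ∧ 2 * (i.val + 1) ≤ k + 2 ∧ (j.val + 1) + (i.val + 1) = k + 3 then
      (k.choose (2 * (i.val + 1) - 3) : ℂ)
    else if i = j then 1 else 0

/-- `T := (T_F⁻¹ · K_{k3} · K_{k2})⁻¹`. -/
noncomputable def Tmonodromy (k : ℕ) : Matrix (Fin k) (Fin k) ℂ :=
  ((TFmat k)⁻¹ * Kk3mat k * Kk2mat k)⁻¹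

/-- The Stokes matrix of the quantum cohomology of `CP^{k-1}`:
`S = T_F^{k/2} · T^{-(k/2)}` for `k` even, `S = T_F^{(k-1)/2} · K_{k2} · T^{-((k-1)/2)}`
for `k` odd. -/
noncomputable def Smat (k : ℕ) : Matrix (Fin k) (Fin k) ℂ :=
  if k % 2 = 0 then (TFmat k) ^ (k / 2) * ((Tmonodromy k)⁻¹) ^ (k / 2)
  else (TFmat k) ^ ((k - 1) / 2) * Kk2mat k * ((Tmonodromy k)⁻¹) ^ ((k - 1) / 2)

/-- The matrix `A` of the positive braid move at (0-based) position `p`, `p+1`. -/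
def braidAmat (k p : ℕ) (hp : p + 1 < k) (M : Matrix (Fin k) (Fin k) ℂ) :
    Matrix (Fin k) (Fin k) ℂ :=
  Matrix.of fun n m =>
    if n.val = p ∧ m.val = p + 1 then 1
    else if n.val = p + 1 ∧ m.val = p then 1
    else if n.val = p + 1 ∧ m.val = p + 1 then -(M ⟨p, Nat.lt_of_succ_lt hp⟩ ⟨p + 1, hp⟩)
    else if n = m ∧ n.val ≠ p ∧ n.val ≠ p + 1 then 1 else 0

/-- One positive braid move: `M ↦ A·M·Aᵀ`. -/
def posBraidMove (k : ℕ) (M M' : Matrix (Fin k) (Fin k) ℂ) : Prop :=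
  ∃ p, ∃ hp : p + 1 < k, M' = braidAmat k p hp M * M * (braidAmat k p hp M)ᵀ

/-- The canonical form `C_k`, `(C_k)_{ij} = C(k, j-i)` for `i ≤ j`, `0` below the diagonal:
the Gram matrix of the Euler form on the full exceptional collection
`O, O(1), …, O(k-1)` on `CP^{k-1}`. -/
def Ckmat (k : ℕ) : Matrix (Fin k) (Fin k) ℂ :=
  Matrix.of fun i j => if i.val ≤ j.val then (k.choose (j.val - i.val) : ℂ) else 0


/-- The matrix `B` of the negative braid move at (0-based) position `p`, `p+1`. -/
def braidBmat (k p : ℕ) (hp : p + 1 < k) (M : Matrix (Fin k) (Fin k) ℂ) :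
    Matrix (Fin k) (Fin k) ℂ :=
  Matrix.of fun n m =>
    if n.val = p ∧ m.val = p then -(M ⟨p, Nat.lt_of_succ_lt hp⟩ ⟨p + 1, hp⟩)
    else if n.val = p ∧ m.val = p + 1 then 1
    else if n.val = p + 1 ∧ m.val = p then 1
    else if n = m ∧ n.val ≠ p ∧ n.val ≠ p + 1 then 1 else 0

/-- One negative braid move: `M ↦ B·M·Bᵀ`. -/
def negBraidMove (k : ℕ) (M M' : Matrix (Fin k) (Fin k) ℂ) : Prop :=
  ∃ p, ∃ hp : p + 1 < k, M' = braidBmat k p hp M * M * (braidBmat k p hp M)ᵀ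

section LinearAction

variable {V : Type*} [AddCommGroup V] [Module ℂ V] {k : ℕ}

/-- The action of a matrix on a family of vectors. -/
def matAct (M : Matrix (Fin k) (Fin k) ℂ) (v : Fin k → V) : Fin k → V :=
  fun i => ∑ j, M i j • v j

/-- The Gram matrix of a family of vectors. -/
def gramOf (B : V →ₗ[ℂ] V →ₗ[ℂ] ℂ) (v : Fin k → V) : Matrix (Fin k) (Fin k) ℂ :=
  Matrix.of fun i j => B (v i) (v j)

lemma matAct_mul (M N : Matrix (Fin k) (Fin k) ℂ) (v : Fin k → V) :
    matAct (M * N) v = matAct M (matAct N v) := by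
  funext i
  simp only [matAct, Matrix.mul_apply, Finset.sum_smul, Finset.smul_sum, smul_smul]
  exact Finset.sum_comm

lemma matAct_one (v : Fin k → V) : matAct 1 v = v := by
  funext i
  simp [matAct, Matrix.one_apply]

lemma matAct_apply_of_row {M : Matrix (Fin k) (Fin k) ℂ} {i a b : Fin k} {α β : ℂ}
    (h : ∀ j, M i j = (if j = a then α else 0) + (if j = b then β else 0)) (v : Fin k → V) :
    matAct M v i = α • v a + β • v b := by
  simp [matAct, h, add_smul, Finset.sum_add_distrib, ite_smul]

lemma mul_gramOf (B : V →ₗ[ℂ] V →ₗ[ℂ] ℂ) (M : Matrix (Fin k) (Fin k) ℂ) (v : Fin k → V) :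
    M * gramOf B v = Matrix.of fun i j => B (matAct M v i) (v j) := by
  ext i j
  simp [gramOf, matAct, Matrix.mul_apply]

lemma mul_gramOf_mul_transpose (B : V →ₗ[ℂ] V →ₗ[ℂ] ℂ) (M : Matrix (Fin k) (Fin k) ℂ)
    (v : Fin k → V) : M * gramOf B v * Mᵀ = gramOf B (matAct M v) := by
  rw [mul_gramOf]
  ext i j
  simp [gramOf, matAct, Matrix.mul_apply, mul_comm]

lemma posBraidMove_gramOf (B : V →ₗ[ℂ] V →ₗ[ℂ] ℂ) {p : ℕ} (hp : p + 1 < k) {v w : Fin k → V}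
    (h₀ : w ⟨p, by omega⟩ = v ⟨p + 1, hp⟩)
    (h₁ : w ⟨p + 1, hp⟩ =
      v ⟨p, by omega⟩ - B (v ⟨p, by omega⟩) (v ⟨p + 1, hp⟩) • v ⟨p + 1, hp⟩)
    (h : ∀ i : Fin k, i.val ≠ p → i.val ≠ p + 1 → w i = v i) :
    posBraidMove k (gramOf B v) (gramOf B w) := by
  refine ⟨p, hp, ?_⟩
  rw [mul_gramOf_mul_transpose]
  congr 1
  funext i
  by_cases hi₀ : i.val = p
  · rw [show i = ⟨p, by omega⟩ from Fin.ext hi₀]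
    rw [matAct_apply_of_row (a := ⟨p + 1, hp⟩) (b := ⟨p + 1, hp⟩) (α := 1) (β := 0), h₀]
    · simp
    · intro j
      simp only [braidAmat, Matrix.of_apply, Fin.ext_iff]
      split_ifs <;> first | omega | simp_all
  by_cases hi₁ : i.val = p + 1
  · rw [show i = ⟨p + 1, hp⟩ from Fin.ext hi₁]
    rw [matAct_apply_of_row (a := ⟨p, by omega⟩) (b := ⟨p + 1, hp⟩) (α := 1)
      (β := - B (v ⟨p, by omega⟩) (v ⟨p + 1, hp⟩)), h₁]
    · simp [sub_eq_add_neg]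
    · intro j
      simp only [braidAmat, gramOf, Matrix.of_apply, Fin.ext_iff]
      split_ifs <;> first | omega | simp_all
  · rw [matAct_apply_of_row (a := i) (b := i) (α := 1) (β := 0), h i hi₀ hi₁]
    · simp
    · intro j
      simp only [braidAmat, Matrix.of_apply, Fin.ext_iff]
      split_ifs <;> first | omega | simp

end LinearAction

section StokesFactors

variable {V : Type*} [AddCommGroup V] [Module ℂ V] {k : ℕ}

lemma isUnit_of_sub_one_mul_self {M : Matrix (Fin k) (Fin k) ℂ}
    (h : ∀ i j l, (M - 1) i j * (M - 1) j l = 0) : IsUnit M := by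
  have hnil : IsNilpotent (M - 1) := ⟨2, by
    ext i l
    rw [pow_two, Matrix.mul_apply, Matrix.zero_apply]
    exact Finset.sum_eq_zero fun j _ => h i j l⟩
  simpa using hnil.isUnit_one_add

lemma isUnit_Kk2mat (k : ℕ) : IsUnit (Kk2mat k) := by
  refine isUnit_of_sub_one_mul_self fun i j l => ?_
  simp only [Kk2mat, Matrix.sub_apply, Matrix.of_apply, Matrix.one_apply, Fin.ext_iff]
  split_ifs <;> first | omega | simp

lemma isUnit_Kk3mat (k : ℕ) : IsUnit (Kk3mat k) := by
  refine isUnit_of_sub_one_mul_self fun i j l => ?_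
  simp only [Kk3mat, Matrix.sub_apply, Matrix.of_apply, Matrix.one_apply, Fin.ext_iff]
  split_ifs <;> first | omega | simp

/-- The action of `TFmat k` on families indexed by natural numbers. -/
def signedShift (k : ℕ) (v : ℕ → V) : ℕ → V :=
  fun i => if i = 0 then v (k - 1) else -v (i - 1)

lemma matAct_TFmat (v : ℕ → V) :
    matAct (TFmat k) (fun i => v i) = fun i : Fin k => signedShift k v i := by
  funext i
  by_cases hi : i.val = 0
  · rw [matAct_apply_of_row (a := ⟨k - 1, by omega⟩) (b := i) (α := 1) (β := 0)]
    · simp [signedShift, hi]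
    · intro j
      simp only [TFmat, Matrix.of_apply, Fin.ext_iff]
      split_ifs <;> first | omega | simp
  · rw [matAct_apply_of_row (a := ⟨i.val - 1, by omega⟩) (b := i) (α := -1) (β := 0)]
    · simp [signedShift, hi]
    · intro j
      simp only [TFmat, Matrix.of_apply, Fin.ext_iff]
      split_ifs <;> first | omega | simp

lemma matAct_TFmat_pow (v : ℕ → V) (m : ℕ) :
    matAct (TFmat k ^ m) (fun i => v i) = fun i : Fin k => (signedShift k)^[m] v i := by
  induction m generalizing v with
  | zero => simp [matAct_one]
  | succ m ih => rw [pow_succ, matAct_mul, matAct_TFmat, ih, Function.iterate_succ_apply]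

lemma signedShift_iterate (v : ℕ → V) {m : ℕ} (hm : m ≤ k) {i : ℕ} (hi : i < k) :
    (signedShift k)^[m] v i =
      if m ≤ i then (-1 : ℂ) ^ m • v (i - m) else -((-1 : ℂ) ^ m • v (k + i - m)) := by
  induction m generalizing i with
  | zero => simp
  | succ m ih =>
    rw [Function.iterate_succ_apply', signedShift]
    by_cases h0 : i = 0
    · subst h0
      rw [if_pos rfl, ih (by omega) (by omega), if_pos (by omega), if_neg (by omega), pow_succ,
        show k - 1 - m = k + 0 - (m + 1) by omega]
      simp
    · rw [if_neg h0, ih (by omega) (by omega), pow_succ]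
      by_cases hmi : m + 1 ≤ i
      · rw [if_pos (by omega), if_pos hmi, show i - 1 - m = i - (m + 1) by omega]
        simp
      · rw [if_neg (by omega), if_neg hmi, show k + (i - 1) - m = k + i - (m + 1) by omega]
        simp

lemma isUnit_TFmat (hk : k ≠ 0) : IsUnit (TFmat k) := by
  have h : TFmat k ^ k = (-(-1 : ℂ) ^ k) • (1 : Matrix (Fin k) (Fin k) ℂ) := by
    ext i j
    have h := congrFun (matAct_TFmat_pow (k := k) (fun n => if n = j.val then (1 : ℂ) else 0) k) i
    rw [signedShift_iterate _ le_rfl i.isLt, if_neg (by omega)] at h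
    simpa [matAct, ← Fin.ext_iff, Matrix.one_apply, neg_ite] using h
  rw [← isUnit_pow_iff hk, h, ← Algebra.algebraMap_eq_smul_one]
  exact (IsUnit.mk0 _ (by simp)).map _

lemma inv_Tmonodromy (hk : k ≠ 0) : (Tmonodromy k)⁻¹ = (TFmat k)⁻¹ * Kk3mat k * Kk2mat k := by
  refine Matrix.nonsing_inv_nonsing_inv _ ((Matrix.isUnit_iff_isUnit_det _).1 ?_)
  exact (((Matrix.isUnit_nonsing_inv_iff).2 (isUnit_TFmat hk)).mul (isUnit_Kk3mat k)).mul
    (isUnit_Kk2mat k)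

end StokesFactors

section Helix

variable {V : Type*} [AddCommGroup V] [Module ℂ V] {k : ℕ}

/-- The truncated Koszul sum `∑_{q < L} (-1)^q C(k, q) x_{n+q}`. -/
def koszul (k : ℕ) (x : ℤ → V) (n : ℤ) (L : ℕ) : V :=
  ∑ q ∈ Finset.range L, ((-1) ^ q * (k.choose q : ℂ)) • x (n + q)

/-- The classes of the line bundles `O(n)` in the Grothendieck group of `CP^{k-1}`, with the
relations and the values of the Euler form that determine it. -/
structure IsHelix (k : ℕ) (x : ℤ → V) (B : V →ₗ[ℂ] V →ₗ[ℂ] ℂ) : Prop where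
  koszul_eq_zero : ∀ n, koszul k x n (k + 1) = 0
  form_self : ∀ n, B (x n) (x n) = 1
  form_eq_zero : ∀ n s : ℤ, n - k < s → s < n → B (x n) (x s) = 0

lemma koszul_succ (x : ℤ → V) (n : ℤ) (L : ℕ) :
    koszul k x n (L + 1) = koszul k x n L + ((-1) ^ L * (k.choose L : ℂ)) • x (n + L) :=
  Finset.sum_range_succ _ _

lemma koszul_one (x : ℤ → V) (n : ℤ) : koszul k x n 1 = x n := by
  simp [koszul]

lemma smul_koszul_succ (x : ℤ → V) {n s : ℤ} {i j L : ℕ} (hj : j = i + L) (hs : s = n + L) :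
    (1 : ℂ) • (-1 : ℂ) ^ i • koszul k x n L + (k.choose L : ℂ) • (-1 : ℂ) ^ j • x s =
      (-1 : ℂ) ^ i • koszul k x n (L + 1) := by
  subst hj hs
  rw [koszul_succ, smul_add, one_smul, smul_smul, smul_smul, pow_add]
  congr 2
  ring

lemma form_koszul_right (x : ℤ → V) (B : V →ₗ[ℂ] V →ₗ[ℂ] ℂ) (u : V) (n : ℤ) (L : ℕ) :
    B u (koszul k x n L) =
      ∑ q ∈ Finset.range L, ((-1) ^ q * (k.choose q : ℂ)) * B u (x (n + q)) := by
  simp [koszul]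

namespace IsHelix

variable {x : ℤ → V} {B : V →ₗ[ℂ] V →ₗ[ℂ] ℂ}

lemma koszul_self (h : IsHelix k x B) (n : ℤ) : koszul k x n k = -((-1 : ℂ) ^ k • x (n + k)) := by
  have := h.koszul_eq_zero n
  rw [koszul_succ] at this
  simpa using eq_neg_of_add_eq_zero_left this

/-- A truncated Koszul sum is minus its complement in the full Koszul relation. -/
lemma koszul_eq_neg_sum (h : IsHelix k x B) (n : ℤ) {L : ℕ} (hL : L ≤ k + 1) :
    koszul k x n L =
      -∑ q ∈ Finset.Ico L (k + 1), ((-1) ^ q * (k.choose q : ℂ)) • x (n + q) := by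
  have := h.koszul_eq_zero n
  rw [koszul, ← Finset.sum_range_add_sum_Ico _ hL] at this
  exact eq_neg_of_add_eq_zero_left this

lemma form_koszul_left (h : IsHelix k x B) {n s : ℤ} {L : ℕ} (hL : L ≤ k + 1)
    (h₀ : n + L - 1 - k < s) (h₁ : s < n + L) :
    B (koszul k x n L) (x s) = if s = n then 1 else 0 := by
  rcases lt_trichotomy s n with hs | rfl | hs
  · rw [if_neg hs.ne, koszul, map_sum, LinearMap.sum_apply]
    refine Finset.sum_eq_zero fun q hq => ?_
    have hq := Finset.mem_range.1 hq
    simp [h.form_eq_zero (n + q) s (by omega) (by omega)]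
  · rw [if_pos rfl, koszul, map_sum, LinearMap.sum_apply,
      Finset.sum_eq_single_of_mem 0 (Finset.mem_range.2 (by omega))]
    · simp [h.form_self]
    · intro q hq hq₀
      have hq := Finset.mem_range.1 hq
      simp [h.form_eq_zero (s + q) s (by omega) (by omega)]
  · rw [if_neg hs.ne', h.koszul_eq_neg_sum n hL, map_neg, LinearMap.neg_apply, map_sum,
      LinearMap.sum_apply, neg_eq_zero]
    refine Finset.sum_eq_zero fun q hq => ?_
    have hq := Finset.mem_Ico.1 hq
    simp [h.form_eq_zero (n + q) s (by omega) (by omega)]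

lemma form_koszul_next (h : IsHelix k x B) {n s : ℤ} {L : ℕ} (hL : L < k)
    (hL₀ : 0 < L) (hs : s = n + L) :
    B (koszul k x n L) (x s) = -((-1) ^ L * (k.choose L : ℂ)) := by
  have h₁ := h.form_koszul_left (n := n) (s := n + L) (L := L + 1) (by omega)
    (by push_cast; omega) (by push_cast; omega)
  rw [koszul_succ, if_neg (by omega)] at h₁
  subst hs
  simpa [h.form_self] using eq_neg_of_add_eq_zero_left (by simpa [h.form_self] using h₁)

end IsHelix

/-- The family carried by the Stokes matrix, shifted by `m`. -/
def stokesFamily (k : ℕ) (x : ℤ → V) (m i : ℕ) : V :=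
  (-1 : ℂ) ^ i • koszul k x (i + m) (max 1 (k - 2 * i))

/-- The image of `stokesFamily` under `Kk2mat`. -/
def halfStepFamily (k : ℕ) (x : ℤ → V) (m i : ℕ) : V :=
  (-1 : ℂ) ^ i • koszul k x (i + m)
    (if 1 ≤ i ∧ 2 * i + 1 ≤ k then k - 2 * i + 1 else max 1 (k - 2 * i))

/-- The image of `stokesFamily` under `Smat`. -/
def dualFamily (k : ℕ) (x : ℤ → V) (i : ℕ) : V :=
  if 2 * i < k then -((-1 : ℂ) ^ (i + k) • x (k + i))
  else (-1 : ℂ) ^ i • koszul k x i (2 * k - 2 * i)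

lemma matAct_Kk2mat_stokesFamily (x : ℤ → V) (m : ℕ) :
    matAct (Kk2mat k) (fun i => stokesFamily k x m i) = fun i : Fin k => halfStepFamily k x m i := by
  funext i
  by_cases hi : 1 ≤ i.val ∧ 2 * i.val + 1 ≤ k
  · rw [matAct_apply_of_row (a := i) (b := ⟨k - i, by omega⟩) (α := 1)
      (β := (k.choose (2 * i.val) : ℂ))]
    · rw [halfStepFamily, if_pos hi, stokesFamily, stokesFamily,
        show max 1 (k - 2 * i.val) = k - 2 * i.val by omega,
        show max 1 (k - 2 * (k - i.val)) = 1 by omega, koszul_one,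
        ← Nat.choose_symm (by omega : 2 * i.val ≤ k),
        smul_koszul_succ _ (by dsimp only; omega) (by dsimp only; omega)]
    · intro j
      simp only [Kk2mat, Matrix.of_apply, Fin.ext_iff]
      split_ifs <;> first | omega | simp
  · rw [matAct_apply_of_row (a := i) (b := i) (α := 1) (β := 0)]
    · rw [halfStepFamily, if_neg hi, stokesFamily]
      simp
    · intro j
      simp only [Kk2mat, Matrix.of_apply, Fin.ext_iff]
      split_ifs <;> first | omega | simp

namespace IsHelix

variable {x : ℤ → V} {B : V →ₗ[ℂ] V →ₗ[ℂ] ℂ}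

lemma matAct_Kk3mat_halfStepFamily (h : IsHelix k x B) (hk : 3 ≤ k) (m : ℕ) :
    matAct (Kk3mat k) (fun i => halfStepFamily k x m i) =
      fun i : Fin k => signedShift k (stokesFamily k x (m + 1)) i := by
  funext i
  by_cases hi₀ : i.val = 0
  · rw [matAct_apply_of_row (a := i) (b := i) (α := 1) (β := 0)]
    · obtain ⟨n, rfl⟩ : ∃ n, k = n + 1 := ⟨k - 1, by omega⟩
      rw [signedShift, if_pos hi₀, halfStepFamily, stokesFamily, hi₀,
        show max 1 (n + 1 - 2 * (n + 1 - 1)) = 1 by omega, koszul_one]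
      simp [h.koszul_self, pow_succ, add_comm, add_left_comm]
    · intro j
      simp only [Kk3mat, Matrix.of_apply, Fin.ext_iff]
      split_ifs <;> first | omega | simp
  have hR : signedShift k (stokesFamily k x (m + 1)) i =
      (-1 : ℂ) ^ i.val • koszul k x (i + m) (max 1 (k + 2 - 2 * i.val)) := by
    obtain ⟨n, hn⟩ : ∃ n, i.val = n + 1 := ⟨i.val - 1, by omega⟩
    rw [signedShift, if_neg hi₀, stokesFamily, hn,
      show k + 2 - 2 * (n + 1) = k - 2 * n by omega, pow_succ,
      show ((n + 1 : ℕ) : ℤ) + m = (n + 1 - 1 : ℕ) + (m + 1 : ℕ) by omega]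
    simp
  rw [hR]
  by_cases hi₁ : i.val = 1
  · rw [matAct_apply_of_row (a := i) (b := ⟨0, by omega⟩) (α := 1) (β := -(k : ℂ))]
    · obtain ⟨n, rfl⟩ : ∃ n, k = n + 1 := ⟨k - 1, by omega⟩
      rw [halfStepFamily, halfStepFamily, hi₁, if_pos (by omega), if_neg (by simp),
        show max 1 (n + 1 + 2 - 2 * 1) = n + 1 by omega,
        show n + 1 - 2 * 1 + 1 = n by omega, koszul_succ,
        show max 1 (n + 1 - 2 * 0) = n + 1 by omega, h.koszul_self,
        show ((0 : ℕ) : ℤ) + m + (n + 1 : ℕ) = (1 : ℕ) + m + n by push_cast; ring]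
      simp only [Nat.choose_succ_self_right, Nat.cast_add, Nat.cast_one]
      module
    · intro j
      simp only [Kk3mat, Matrix.of_apply, Fin.ext_iff]
      split_ifs <;> first | omega | simp
  by_cases hi₂ : 2 * i.val ≤ k
  · rw [matAct_apply_of_row (a := i) (b := ⟨k + 1 - i, by omega⟩) (α := 1)
      (β := (k.choose (2 * i.val - 1) : ℂ))]
    · have hL : (if 1 ≤ i.val ∧ 2 * i.val + 1 ≤ k then k - 2 * i.val + 1
          else max 1 (k - 2 * i.val)) = k + 1 - 2 * i.val := by
        split_ifs <;> omega
      rw [halfStepFamily, halfStepFamily, hL, if_neg (by simp; omega),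
        show max 1 (k + 2 - 2 * i.val) = k + 1 - 2 * i.val + 1 by omega,
        show max 1 (k - 2 * (k + 1 - i.val)) = 1 by omega, koszul_one,
        show k + 1 - 2 * i.val = k - (2 * i.val - 1) by omega,
        ← Nat.choose_symm (by omega : 2 * i.val - 1 ≤ k),
        smul_koszul_succ _ (by dsimp only; omega) (by dsimp only; omega)]
    · intro j
      simp only [Kk3mat, Matrix.of_apply, Fin.ext_iff,
        show 2 * (i.val + 1) - 3 = 2 * i.val - 1 by omega]
      split_ifs <;> first | omega | simp
  · rw [matAct_apply_of_row (a := i) (b := i) (α := 1) (β := 0)]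
    · rw [halfStepFamily, if_neg (by omega), show max 1 (k - 2 * i.val) = 1 by omega,
        show max 1 (k + 2 - 2 * i.val) = 1 by omega]
      simp
    · intro j
      simp only [Kk3mat, Matrix.of_apply, Fin.ext_iff]
      split_ifs <;> first | omega | simp

lemma matAct_inv_Tmonodromy_pow (h : IsHelix k x B) (hk : 3 ≤ k) (m : ℕ) :
    matAct ((Tmonodromy k)⁻¹ ^ m) (fun i => stokesFamily k x 0 i) =
      fun i : Fin k => stokesFamily k x m i := by
  induction m with
  | zero => simp [matAct_one]
  | succ m ih =>
    rw [pow_succ', matAct_mul, ih, inv_Tmonodromy (by omega), Matrix.mul_assoc, matAct_mul,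
      matAct_mul, matAct_Kk2mat_stokesFamily, h.matAct_Kk3mat_halfStepFamily hk, ← matAct_TFmat,
      ← matAct_mul, Matrix.nonsing_inv_mul _
        ((Matrix.isUnit_iff_isUnit_det _).1 (isUnit_TFmat (by omega))), matAct_one]

lemma matAct_Smat (h : IsHelix k x B) (hk : 3 ≤ k) :
    matAct (Smat k) (fun i => stokesFamily k x 0 i) = fun i : Fin k => dualFamily k x i := by
  funext i
  have hi := i.isLt
  rw [Smat]
  split_ifs with hpar
  · obtain ⟨m, rfl⟩ : ∃ m, k = 2 * m := ⟨k / 2, by omega⟩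
    rw [show 2 * m / 2 = m by omega, matAct_mul, h.matAct_inv_Tmonodromy_pow hk, matAct_TFmat_pow]
    beta_reduce
    rw [signedShift_iterate _ (by omega) hi, dualFamily]
    by_cases hmi : m ≤ i.val
    · rw [if_pos hmi, if_neg (by omega), stokesFamily, smul_smul, ← pow_add,
        show m + (i.val - m) = i.val by omega,
        show max 1 (2 * m - 2 * (i.val - m)) = 2 * (2 * m) - 2 * i.val by omega,
        show ((i.val - m : ℕ) : ℤ) + m = i.val by omega]
    · rw [if_neg hmi, if_pos (by omega), stokesFamily, smul_smul, ← pow_add,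
        show m + (2 * m + i.val - m) = i.val + 2 * m by omega,
        show max 1 (2 * m - 2 * (2 * m + i.val - m)) = 1 by omega, koszul_one,
        show ((2 * m + i.val - m : ℕ) : ℤ) + m = (2 * m : ℕ) + i.val by omega]
  · obtain ⟨m, rfl⟩ : ∃ m, k = 2 * m + 1 := ⟨k / 2, by omega⟩
    rw [show (2 * m + 1 - 1) / 2 = m by omega, matAct_mul, matAct_mul,
      h.matAct_inv_Tmonodromy_pow hk, matAct_Kk2mat_stokesFamily, matAct_TFmat_pow]
    beta_reduce
    rw [signedShift_iterate _ (by omega) hi, dualFamily]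
    rcases lt_trichotomy m i.val with hmi | hmi | hmi
    · rw [if_pos hmi.le, if_neg (by omega), halfStepFamily, if_pos (by omega), smul_smul, ← pow_add,
        show m + (i.val - m) = i.val by omega,
        show 2 * m + 1 - 2 * (i.val - m) + 1 = 2 * (2 * m + 1) - 2 * i.val by omega,
        show ((i.val - m : ℕ) : ℤ) + m = i.val by omega]
    · rw [if_pos hmi.le, if_pos (by omega), halfStepFamily, if_neg (by omega), ← hmi, Nat.sub_self,
        show max 1 (2 * m + 1 - 2 * 0) = 2 * m + 1 by omega, h.koszul_self,
        show ((0 : ℕ) : ℤ) + m + (2 * m + 1 : ℕ) = (2 * m + 1 : ℕ) + m by push_cast; ring,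
        pow_add _ m (2 * m + 1)]
      simp [pow_succ _ (2 * m), pow_mul]
    · rw [if_neg (by omega), if_pos (by omega), halfStepFamily, if_neg (by omega), smul_smul,
        ← pow_add, show m + (2 * m + 1 + i.val - m) = i.val + (2 * m + 1) by omega,
        show max 1 (2 * m + 1 - 2 * (2 * m + 1 + i.val - m)) = 1 by omega, koszul_one,
        show ((2 * m + 1 + i.val - m : ℕ) : ℤ) + m = (2 * m + 1 : ℕ) + i.val by omega]

end IsHelix

end Helix

section Braid

variable {V : Type*} [AddCommGroup V] [Module ℂ V] {k : ℕ} {x : ℤ → V}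
  {B : V →ₗ[ℂ] V →ₗ[ℂ] ℂ}

lemma IsHelix.form_koszul_right_compl (h : IsHelix k x B) (u : V) (n : ℤ) {L : ℕ}
    (hL : L ≤ k + 1) : B u (koszul k x n L) =
      -∑ q ∈ Finset.Ico L (k + 1), ((-1) ^ q * (k.choose q : ℂ)) * B u (x (n + q)) := by
  simp [h.koszul_eq_neg_sum n hL]

lemma IsHelix.form_dualFamily_stokesFamily (h : IsHelix k x B) {i l : ℕ} (hi : i < k) (hl : l < k) :
    B (dualFamily k x i) (stokesFamily k x 0 l) = if i = l then 1 else 0 := by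
  rw [dualFamily, stokesFamily, Nat.cast_zero, add_zero]
  by_cases hik : 2 * i < k
  · rw [if_pos hik]
    by_cases hlk : 2 * l < k
    · rw [show max 1 (k - 2 * l) = k - 2 * l by omega]
      rcases lt_trichotomy i l with hil | rfl | hil
      · rw [if_neg hil.ne, map_smul, form_koszul_right, Finset.sum_eq_zero, smul_zero]
        intro q hq
        have hq := Finset.mem_range.1 hq
        simp [h.form_eq_zero (k + i) (l + q) (by omega) (by omega)]
      · rw [if_pos rfl, map_smul, h.form_koszul_right_compl _ _ (by omega),
          Finset.sum_eq_single_of_mem k (Finset.mem_Ico.2 (by omega))]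
        · rw [add_comm (k : ℤ)]
          simp [h.form_self, pow_add]
          ring_nf
          simp [pow_mul']
        · intro q hq hqk
          have hq := Finset.mem_Ico.1 hq
          simp [h.form_eq_zero (k + i) (i + q) (by omega) (by omega)]
      · rw [if_neg hil.ne', map_smul, h.form_koszul_right_compl _ _ (by omega),
          Finset.sum_eq_zero, neg_zero, smul_zero]
        intro q hq
        have hq := Finset.mem_Ico.1 hq
        simp [h.form_eq_zero (k + i) (l + q) (by omega) (by omega)]
    · rw [show max 1 (k - 2 * l) = 1 by omega, koszul_one, if_neg (by omega)]
      simp [h.form_eq_zero (k + i) l (by omega) (by omega)]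
  · rw [if_neg hik]
    have key : ∀ s : ℤ, k - 1 - i < s → s < 2 * k - i →
        B ((-1 : ℂ) ^ i • koszul k x i (2 * k - 2 * i)) (x s) =
          (-1 : ℂ) ^ i * if s = i then 1 else 0 := fun s h₀ h₁ => by
      rw [map_smul, LinearMap.smul_apply, h.form_koszul_left (by omega) (by omega) (by omega),
        smul_eq_mul]
    by_cases hlk : 2 * l < k
    · rw [show max 1 (k - 2 * l) = k - 2 * l by omega, if_neg (by omega), map_smul]
      by_cases hil : k - i ≤ l
      · rw [form_koszul_right, Finset.sum_eq_zero, smul_zero]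
        intro q hq
        have hq := Finset.mem_range.1 hq
        rw [key _ (by omega) (by omega), if_neg (by omega), mul_zero, mul_zero]
      · rw [h.form_koszul_right_compl _ _ (by omega), Finset.sum_eq_zero, neg_zero, smul_zero]
        intro q hq
        have hq := Finset.mem_Ico.1 hq
        rw [key _ (by omega) (by omega), if_neg (by omega), mul_zero, mul_zero]
    · rw [show max 1 (k - 2 * l) = 1 by omega, koszul_one, map_smul, key _ (by omega) (by omega)]
      by_cases hil : i = l
      · subst hil
        simp [← mul_pow]
      · rw [if_neg (by omega), if_neg hil, mul_zero, smul_zero]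

lemma IsHelix.inv_Smat (h : IsHelix k x B) (hk : 3 ≤ k) :
    (Smat k)⁻¹ = gramOf B (fun i : Fin k => stokesFamily k x 0 i) := by
  refine Matrix.inv_eq_right_inv ?_
  rw [mul_gramOf, h.matAct_Smat hk]
  ext i l
  simp [h.form_dualFamily_stokesFamily i.isLt l.isLt, Matrix.one_apply, Fin.ext_iff]

/-- Braid moves and sign changes carry `M` to `Ckmat k`. -/
def ReachesCkmat (k : ℕ) (M : Matrix (Fin k) (Fin k) ℂ) : Prop :=
  ∃ S'' : Matrix (Fin k) (Fin k) ℂ,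
    Relation.ReflTransGen (fun M M' => posBraidMove k M M' ∨ negBraidMove k M M') M S'' ∧
    ∃ d : Fin k → ℂ, (∀ i, d i = 1 ∨ d i = -1) ∧
      Matrix.diagonal d * S'' * Matrix.diagonal d = Ckmat k

lemma ReachesCkmat.of_posBraidMove {M M' : Matrix (Fin k) (Fin k) ℂ} (h : posBraidMove k M M')
    (h' : ReachesCkmat k M') : ReachesCkmat k M := by
  obtain ⟨S, hS, hd⟩ := h'
  exact ⟨S, hS.head (Or.inl h), hd⟩

/-- The Gram matrix of the family, with any choice of signs, reaches `Ckmat k`. -/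
def SignReaches (k : ℕ) (B : V →ₗ[ℂ] V →ₗ[ℂ] ℂ) (v : Fin k → V) : Prop :=
  ∀ d : Fin k → ℂ, (∀ i, d i = 1 ∨ d i = -1) → ReachesCkmat k (gramOf B fun i => d i • v i)

lemma SignReaches.of_mutation {p : ℕ} (hp : p + 1 < k) {v w : Fin k → V}
    (h₀ : w ⟨p, by omega⟩ = v ⟨p + 1, hp⟩)
    (h₁ : w ⟨p + 1, hp⟩ =
      v ⟨p, by omega⟩ - B (v ⟨p, by omega⟩) (v ⟨p + 1, hp⟩) • v ⟨p + 1, hp⟩)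
    (h : ∀ i : Fin k, i.val ≠ p → i.val ≠ p + 1 → w i = v i)
    (hw : SignReaches k B w) : SignReaches k B v := by
  intro d hd
  refine .of_posBraidMove (posBraidMove_gramOf B hp
    (w := fun i => d (Equiv.swap ⟨p, by omega⟩ ⟨p + 1, hp⟩ i) • w i) ?_ ?_ ?_)
    (hw _ fun i => hd _)
  · simp [h₀]
  · have hsq : d ⟨p + 1, hp⟩ * d ⟨p + 1, hp⟩ = 1 := by
      rcases hd ⟨p + 1, hp⟩ with h | h <;> simp [h]
    simp only [Equiv.swap_apply_right, h₁, map_smul, LinearMap.smul_apply, smul_eq_mul, smul_sub,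
      smul_smul]
    congr 2
    linear_combination (-(d ⟨p, by omega⟩ * B (v ⟨p, by omega⟩) (v ⟨p + 1, hp⟩))) * hsq
  · intro i hi₀ hi₁
    rw [Equiv.swap_apply_of_ne_of_ne (by simpa [Fin.ext_iff] using hi₀)
      (by simpa [Fin.ext_iff] using hi₁), h i hi₀ hi₁]

/-- The first `t` members form the collection right dual to `x (c - t + 1), …, x c`;
the others are those of `e`. -/
def prefixFamily (k : ℕ) (x : ℤ → V) (e : ℕ → V) (c : ℤ) (t a : ℕ) : V :=
  if a < t then koszul k x (c - a) (a + 1) else e a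

/-- The families met while `x (c + 1)` moves left through the first `t` members of
`prefixFamily k x e c t`; here it stands at position `p`. -/
def bubbleFamily (k : ℕ) (x : ℤ → V) (e : ℕ → V) (c : ℤ) (t p a : ℕ) : V :=
  if a < p then koszul k x (c - a) (a + 1) else if a = p then x (c + 1)
  else if a ≤ t then koszul k x (c + 1 - a) (a + 1) else e a

lemma IsHelix.signReaches_bubbleFamily (h : IsHelix k x B) (e : ℕ → V) (c : ℤ) {t p : ℕ}
    (ht : t < k) (hp : p ≤ t)
    (h₀ : SignReaches k B fun i => bubbleFamily k x e c t 0 i) :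
    SignReaches k B fun i => bubbleFamily k x e c t p i := by
  induction p with
  | zero => exact h₀
  | succ p ih =>
    refine (ih (by omega)).of_mutation (p := p) (by omega) ?_ ?_ ?_
    · simp [bubbleFamily]
    · simp only [bubbleFamily]
      rw [if_neg (by omega), if_neg (by omega), if_pos (by omega), if_pos (by omega),
        if_neg (by omega), if_pos trivial,
        h.form_koszul_next (s := c + 1) (by omega) (by omega) (by push_cast; ring), neg_smul,
        sub_neg_eq_add, koszul_succ, show c + 1 - ((p + 1 : ℕ) : ℤ) = c - p by push_cast; ring,
        show c - p + ((p + 1 : ℕ) : ℤ) = c + 1 by push_cast; ring]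
    · intro i hi₀ hi₁
      simp only [bubbleFamily]
      split_ifs <;> first | omega | rfl

lemma IsHelix.signReaches_prefixFamily_of_eq (h : IsHelix k x B) {e : ℕ → V} {c : ℤ} {t : ℕ}
    (ht : t < k) (he : e t = x (c + 1))
    (h₀ : SignReaches k B fun i => prefixFamily k x e (c + 1) (t + 1) i) :
    SignReaches k B fun i => prefixFamily k x e c t i := by
  have h₁ := h.signReaches_bubbleFamily e c (p := t) ht le_rfl (by
    convert h₀ using 2 with i
    simp only [bubbleFamily, prefixFamily]
    split_ifs <;> first | omega | rfl | skip
    simp [show i.val = 0 by omega, koszul_one])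
  convert h₁ using 2 with i
  simp only [bubbleFamily, prefixFamily]
  split_ifs with h₁ h₂ <;> first | omega | rfl | skip
  rw [h₂, he]

lemma signReaches_prefixFamily_of_eq_koszul {e : ℕ → V} {c : ℤ} {t : ℕ}
    (he : e t = koszul k x (c - t) (t + 1))
    (h₀ : SignReaches k B fun i => prefixFamily k x e c (t + 1) i) :
    SignReaches k B fun i => prefixFamily k x e c t i := by
  convert h₀ using 2 with i
  simp only [prefixFamily]
  split_ifs with h₁ h₂ <;> first | omega | rfl | skip
  rw [show i.val = t by omega, he]

lemma IsHelix.form_koszul_koszul (h : IsHelix k x B) {a b : ℕ} (ha : a < k) (hb : b < k) :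
    B (koszul k x (k - 1 - a) (a + 1)) (koszul k x (k - 1 - b) (b + 1)) =
      if a ≤ b then (-1) ^ (b - a) * (k.choose (b - a) : ℂ) else 0 := by
  have key : ∀ q ∈ Finset.range (b + 1),
      B (koszul k x (k - 1 - a) (a + 1)) (x (k - 1 - b + q)) =
        if (k - 1 - b + q : ℤ) = k - 1 - a then 1 else 0 := fun q hq => by
    have hq := Finset.mem_range.1 hq
    exact h.form_koszul_left (by omega) (by push_cast; omega) (by push_cast; omega)
  rw [form_koszul_right, Finset.sum_congr rfl fun q hq => by rw [key q hq]]
  split_ifs with hab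
  · rw [Finset.sum_eq_single_of_mem (b - a) (Finset.mem_range.2 (by omega)),
      if_pos (by omega), mul_one]
    intro q _ hq
    rw [if_neg (by omega), mul_zero]
  · refine Finset.sum_eq_zero fun q _ => ?_
    rw [if_neg (by omega), mul_zero]

lemma IsHelix.signReaches_koszul (h : IsHelix k x B) :
    SignReaches k B fun i => koszul k x (k - 1 - i) (i + 1) := by
  intro d hd
  have hsq : ∀ i, d i * d i = 1 := fun i => by rcases hd i with h | h <;> simp [h]
  refine ⟨_, .refl, fun i => d i * (-1) ^ i.val, fun i => ?_, ?_⟩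
  · rcases hd i with h | h <;> rcases neg_one_pow_eq_or ℂ i.val with h' | h' <;> simp [h, h']
  · ext i j
    simp only [Matrix.mul_diagonal, Matrix.diagonal_mul, gramOf, Matrix.of_apply, map_smul,
      LinearMap.smul_apply, smul_eq_mul, h.form_koszul_koszul i.isLt j.isLt, Ckmat]
    split_ifs with hij
    · have hs : (-1 : ℂ) ^ i.val * (-1) ^ j.val * (-1) ^ (j.val - i.val) = 1 := by
        rw [← pow_add, ← pow_add, show i.val + j.val + (j.val - i.val) = 2 * j.val by omega]
        simp [pow_mul]
      linear_combination (k.choose (j.val - i.val) : ℂ) *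
        ((d i * d i) * (d j * d j) * hs + (d j * d j) * hsq i + hsq j)
    · simp

/-- A collection of truncated Koszul sums in which every new member either extends the current
dual collection or is the next line bundle reaches `Ckmat k`. -/
lemma IsHelix.signReaches_of_interleaving (h : IsHelix k x B) (e : ℕ → V)
    (he : ∀ t < k, e t = if (k + t) % 2 = 0 then x (((k + t) / 2 : ℕ) : ℤ)
      else koszul k x (((k - 1 - t) / 2 : ℕ) : ℤ) (t + 1)) :
    SignReaches k B fun i => e i := by
  have key : ∀ n t, t + n = k →
      SignReaches k B fun i => prefixFamily k x e (((k + t - 1) / 2 : ℕ) : ℤ) t i := by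
    intro n
    induction n with
    | zero =>
      rintro t rfl
      convert h.signReaches_koszul using 2 with i
      rw [prefixFamily, if_pos (by omega)]
      congr 1
      omega
    | succ n ih =>
      intro t ht
      have hnext := ih (t + 1) (by omega)
      by_cases hpar : (k + t) % 2 = 0
      · rw [show (((k + (t + 1) - 1) / 2 : ℕ) : ℤ) = ((k + t - 1) / 2 : ℕ) + 1 by omega] at hnext
        refine h.signReaches_prefixFamily_of_eq (by omega) ?_ hnext
        rw [he t (by omega), if_pos hpar]
        congr 1
        omega
      · rw [show (k + (t + 1) - 1) / 2 = (k + t - 1) / 2 by omega] at hnext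
        refine signReaches_prefixFamily_of_eq_koszul ?_ hnext
        rw [he t (by omega), if_neg hpar]
        congr 1
        omega
  simpa [prefixFamily] using key k 0 (by omega)

end Braid

section Model

/-- The Hilbert polynomial of `CP^{k-1}`. -/
lemma exists_hilbert_function {k : ℕ} (hk : 0 < k) : ∃ f : ℤ → ℂ, f 0 = 1 ∧
    (∀ n : ℤ, -k < n → n < 0 → f n = 0) ∧
    (∀ s : ℤ, ∑ q ∈ Finset.range (k + 1), ((-1) ^ q * (k.choose q : ℂ)) * f (s + q) = 0) ∧
    (∀ s : ℤ, ∑ q ∈ Finset.range (k + 1), ((-1) ^ q * (k.choose q : ℂ)) * f (s - q) = 0) := by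
  let P : Polynomial ℂ := Polynomial.C (((k - 1).factorial : ℂ)⁻¹) *
    ∏ i ∈ Finset.range (k - 1), (Polynomial.X + Polynomial.C ((i : ℂ) + 1))
  have hdeg : P.natDegree < k := by
    refine lt_of_le_of_lt (Polynomial.natDegree_C_mul_le _ _) ?_
    rw [Polynomial.natDegree_prod_of_monic _ _ fun i _ => Polynomial.monic_X_add_C _]
    simp only [Polynomial.natDegree_X_add_C, Finset.sum_const, Finset.card_range, smul_eq_mul]
    omega
  have heval : ∀ z : ℂ, P.eval z =
      ((k - 1).factorial : ℂ)⁻¹ * ∏ i ∈ Finset.range (k - 1), (z + (i + 1)) := fun z => by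
    simp [P, Polynomial.eval_prod]
  have hup : ∀ s : ℤ,
      ∑ q ∈ Finset.range (k + 1), ((-1) ^ q * (k.choose q : ℂ)) * P.eval ((s + q : ℤ) : ℂ) = 0 := by
    intro s
    have h := congrFun (Polynomial.fwdDiff_iter_eq_zero_of_degree_lt hdeg) (s : ℂ)
    rw [fwdDiff_iter_eq_sum_shift] at h
    have h' : (-1 : ℂ) ^ k * ∑ q ∈ Finset.range (k + 1),
        ((-1) ^ q * (k.choose q : ℂ)) * P.eval ((s + q : ℤ) : ℂ) = 0 := by
      rw [← Pi.zero_apply (M := fun _ : ℂ => ℂ) (s : ℂ), ← h, Finset.mul_sum]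
      refine Finset.sum_congr rfl fun q hq => ?_
      have hq := Finset.mem_range.1 hq
      obtain ⟨r, rfl⟩ : ∃ r, k = q + r := ⟨k - q, by omega⟩
      have hsgn : (-1 : ℂ) ^ (q + r) * (-1) ^ q = (-1) ^ r := by
        rw [pow_add, mul_right_comm, ← mul_pow]
        simp
      simp [← hsgn]
      ring
    exact (mul_eq_zero.1 h').resolve_left (by simp)
  refine ⟨fun n => P.eval (n : ℂ), ?_, ?_, hup, ?_⟩
  · have : ∏ i ∈ Finset.range (k - 1), ((i : ℂ) + 1) = ((k - 1).factorial : ℂ) := by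
      rw [← Finset.prod_range_add_one_eq_factorial]
      push_cast
      rfl
    simp [heval, this, Nat.factorial_ne_zero]
  · intro n h₀ h₁
    obtain ⟨i, rfl⟩ : ∃ i : ℕ, n = -((i : ℤ) + 1) := ⟨(-n - 1).toNat, by omega⟩
    beta_reduce
    rw [heval, Finset.prod_eq_zero (Finset.mem_range.2 (by omega : i < k - 1)), mul_zero]
    push_cast
    ring
  · intro s
    rw [← Finset.sum_range_reflect]
    have h := hup (s - k)
    have h' : (-1 : ℂ) ^ k * ∑ q ∈ Finset.range (k + 1),
        ((-1) ^ q * (k.choose q : ℂ)) * P.eval ((s - k + q : ℤ) : ℂ) = 0 := by rw [h, mul_zero]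
    rw [← h', Finset.mul_sum]
    refine Finset.sum_congr rfl fun q hq => ?_
    have hq := Finset.mem_range.1 hq
    obtain ⟨r, rfl⟩ : ∃ r, k = q + r := ⟨k - q, by omega⟩
    have hsgn : (-1 : ℂ) ^ (q + r) * (-1) ^ q = (-1) ^ r := by
      rw [pow_add, mul_right_comm, ← mul_pow]
      simp
    rw [show q + r + 1 - 1 - q = r by omega, ← hsgn, Nat.choose_symm_add,
      show s - ((q + r : ℕ) : ℤ) + q = s - r by push_cast; ring]
    ring

lemma exists_isHelix {k : ℕ} (hk : 0 < k) :
    ∃ (V : Type) (_ : AddCommGroup V) (_ : Module ℂ V) (x : ℤ → V) (B : V →ₗ[ℂ] V →ₗ[ℂ] ℂ),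
      IsHelix k x B := by
  obtain ⟨f, hf₀, hf₁, hf₂, hf₃⟩ := exists_hilbert_function hk
  let y : ℤ → (ℤ →₀ ℂ) := fun n => Finsupp.single n 1
  let F : (ℤ →₀ ℂ) →ₗ[ℂ] (ℤ →₀ ℂ) →ₗ[ℂ] ℂ :=
    Finsupp.linearCombination ℂ fun a => Finsupp.linearCombination ℂ fun b => f (b - a)
  have hF : ∀ a b, F (y a) (y b) = f (b - a) := fun a b => by simp [F, y]
  let N : Submodule ℂ (ℤ →₀ ℂ) := Submodule.span ℂ (Set.range fun n => koszul k y n (k + 1))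
  have hl : N ≤ LinearMap.ker F := by
    refine Submodule.span_le.2 ?_
    rintro _ ⟨n, rfl⟩
    refine LinearMap.mem_ker.2 (Finsupp.lhom_ext' fun b => LinearMap.ext_ring ?_)
    simp only [koszul, map_sum, map_smul, LinearMap.sum_apply, LinearMap.comp_apply,
      LinearMap.smul_apply, smul_eq_mul]
    rw [LinearMap.zero_apply, ← hf₃ (b - n)]
    refine Finset.sum_congr rfl fun q _ => ?_
    change _ * F (y (n + q)) (y b) = _
    rw [hF, sub_sub]
  have hr : N ≤ LinearMap.ker F.flip := by
    refine Submodule.span_le.2 ?_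
    rintro _ ⟨n, rfl⟩
    refine LinearMap.mem_ker.2 (Finsupp.lhom_ext' fun a => LinearMap.ext_ring ?_)
    simp only [koszul, map_sum, map_smul, LinearMap.sum_apply, LinearMap.comp_apply,
      LinearMap.smul_apply, smul_eq_mul]
    rw [LinearMap.zero_apply, ← hf₂ (n - a)]
    refine Finset.sum_congr rfl fun q _ => ?_
    change _ * F (y a) (y (n + q)) = _
    rw [hF, sub_add_eq_add_sub]
  refine ⟨_, _, inferInstance, fun n => N.mkQ (y n), F.liftQ₂ N N hl hr, ?_, ?_, ?_⟩
  · intro n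
    have h : N.mkQ (koszul k y n (k + 1)) = 0 :=
      (Submodule.Quotient.mk_eq_zero N).2 (Submodule.subset_span ⟨n, rfl⟩)
    rw [← h, koszul, koszul, map_sum]
    exact Finset.sum_congr rfl fun q _ => (map_smul _ _ _).symm
  · intro n
    change F (y n) (y n) = 1
    rw [hF, sub_self, hf₀]
  · intro n s h₀ h₁
    change F (y n) (y s) = 0
    rw [hF, hf₁ _ (by omega) (by omega)]

end Model

/-- **Theorem 2′ of the paper.** The inverse `S_upper⁻¹` of the upper triangular form of
the Stokes matrix of the quantum cohomology of `CP^{k-1}` can be carried by finitely many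
positive and negative braid moves and a sign change `S″ ↦ D·S″·D` (`D` diagonal with entries
`±1`) to the Gram matrix `C_k`. -/
theorem inverse_stokes_matrix_of_CP_equals_gram_matrix
    (k : ℕ) (hk : 3 ≤ k) (σ : Equiv.Perm (Fin k))
    (hσ : ∀ a : Fin k, (σ a).val + 1 =
      if k % 2 = 0 then
        (if (a.val + 1) % 2 = 0 then k / 2 + 1 - (a.val + 1) / 2 else k / 2 + (a.val + 2) / 2)
      else
        (if (a.val + 1) % 2 = 0 then (k + 1) / 2 + (a.val + 1) / 2 else (k + 1) / 2 - a.val / 2)) :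
    ∃ S'' : Matrix (Fin k) (Fin k) ℂ,
      Relation.ReflTransGen (fun M M' => posBraidMove k M M' ∨ negBraidMove k M M')
        (((Smat k).submatrix σ σ)⁻¹) S'' ∧
      ∃ d : Fin k → ℂ, (∀ i, d i = 1 ∨ d i = -1) ∧
        Matrix.diagonal d * S'' * Matrix.diagonal d = Ckmat k := by
  obtain ⟨V, _, _, x, B, h⟩ := exists_isHelix (k := k) (by omega)
  rw [Matrix.inv_submatrix_equiv, h.inv_Smat hk]
  let e : ℕ → V := fun t => if ht : t < k then
    koszul k x (σ ⟨t, ht⟩ : ℕ) (max 1 (k - 2 * (σ ⟨t, ht⟩ : ℕ))) else 0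
  have he : ∀ t < k, e t = if (k + t) % 2 = 0 then x (((k + t) / 2 : ℕ) : ℤ)
      else koszul k x (((k - 1 - t) / 2 : ℕ) : ℤ) (t + 1) := by
    intro t ht
    have hv := hσ ⟨t, ht⟩
    simp only [e, dif_pos ht]
    generalize (σ ⟨t, ht⟩).val = s at hv ⊢
    split_ifs with hpar
    · obtain rfl : s = (k + t) / 2 := by split_ifs at hv <;> simp only at * <;> omega
      rw [show max 1 (k - 2 * ((k + t) / 2)) = 1 by omega, koszul_one]
    · obtain rfl : s = (k - 1 - t) / 2 := by split_ifs at hv <;> simp only at * <;> omega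
      rw [show max 1 (k - 2 * ((k - 1 - t) / 2)) = t + 1 by omega]
  have hreach := h.signReaches_of_interleaving e he (fun a => (-1) ^ (σ a).val)
    fun a => neg_one_pow_eq_or ℂ _
  have hgram : (gramOf B fun i : Fin k => stokesFamily k x 0 i).submatrix σ σ =
      gramOf B fun a : Fin k => (-1 : ℂ) ^ (σ a).val • e a := by
    ext a b
    simp [gramOf, stokesFamily, e]
  rw [hgram]
  exact hreach
end

section
/- The matrix S is invertible and T^k = (−1)^{k−1}·S⁻¹·Sᵀ; that is, the k-th power of the monodromy matrix T equals (−1)^{k−1} times S⁻¹·Sᵀ, where S is the Stokes matrix of the quantum cohomology of CP^{k−1} and Sᵀ is its transpose. -/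
open Matrix Complex

lemma TFmat_mul_apply {k : ℕ} (X : Matrix (Fin k) (Fin k) ℂ) (i j : Fin k) :
    (TFmat k * X) i j = if (i : ℕ) = 0 then X ⟨k - 1, Nat.sub_one_lt_of_lt i.isLt⟩ j
      else -X ⟨i - 1, by omega⟩ j := by
  rw [Matrix.mul_apply]
  split_ifs with h
  · rw [Finset.sum_eq_single ⟨k - 1, by omega⟩]
    · simp [TFmat, h]
    · intro l _ hl
      have : (l : ℕ) ≠ k - 1 := fun e => hl (Fin.ext e)
      simp [TFmat, h, this]
    · simp
  · rw [Finset.sum_eq_single ⟨i - 1, by omega⟩]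
    · have : (i : ℕ) = i - 1 + 1 := by omega
      simp [TFmat, h, ← this]
    · intro l _ hl
      have : ¬ (i : ℕ) = l + 1 := fun e => hl (Fin.ext (by simp only; omega))
      simp [TFmat, h, this]
    · simp

lemma mul_TFmat_apply {k : ℕ} (X : Matrix (Fin k) (Fin k) ℂ) (i j : Fin k) :
    (X * TFmat k) i j = if h : (j : ℕ) + 1 < k then -X i ⟨j + 1, h⟩
      else X i ⟨0, by omega⟩ := by
  rw [Matrix.mul_apply]
  split_ifs with h
  · rw [Finset.sum_eq_single ⟨j + 1, h⟩]
    · simp [TFmat]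
    · intro l _ hl
      have h1 : ¬ (l : ℕ) = j + 1 := fun e => hl (Fin.ext e)
      have h2 : ¬ (j : ℕ) = k - 1 := by omega
      simp [TFmat, h1, h2]
    · simp
  · rw [Finset.sum_eq_single ⟨0, by omega⟩]
    · have : (j : ℕ) = k - 1 := by omega
      simp [TFmat, this]
    · intro l _ hl
      have h1 : ¬ (l : ℕ) = 0 := fun e => hl (Fin.ext e)
      have h2 : ¬ (l : ℕ) = j + 1 := by omega
      simp [TFmat, h1, h2]
    · simp

lemma TFmat_pow_mul_apply {k n : ℕ} (hn : n ≤ k) (X : Matrix (Fin k) (Fin k) ℂ) (i j : Fin k) :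
    (TFmat k ^ n * X) i j = if h : n ≤ i then (-1) ^ n * X ⟨i - n, by omega⟩ j
      else (-1) ^ (n + 1) * X ⟨i + k - n, by omega⟩ j := by
  induction n generalizing X with
  | zero => simp
  | succ n ih =>
    rw [pow_succ, mul_assoc, ih (by omega)]
    simp only [TFmat_mul_apply]
    split_ifs with h1 h2 h3 h4 h5
    · omega
    · have : (⟨k - 1, by omega⟩ : Fin k) = ⟨i + k - (n + 1), by omega⟩ :=
        Fin.ext (by simp only; omega)
      rw [this]; ring
    · have : (⟨i - n - 1, by omega⟩ : Fin k) = ⟨i - (n + 1), by omega⟩ :=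
        Fin.ext (by simp only; omega)
      rw [this]; ring
    all_goals try omega
    · have : (⟨i + k - n - 1, by omega⟩ : Fin k) = ⟨i + k - (n + 1), by omega⟩ :=
        Fin.ext (by simp only; omega)
      rw [this]; ring

lemma mul_TFmat_pow_apply {k n : ℕ} (hn : n ≤ k) (X : Matrix (Fin k) (Fin k) ℂ) (i j : Fin k) :
    (X * TFmat k ^ n) i j = if h : (j : ℕ) + n < k then (-1) ^ n * X i ⟨j + n, h⟩
      else (-1) ^ (n + 1) * X i ⟨j + n - k, by omega⟩ := by
  induction n generalizing X with
  | zero => simp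
  | succ n ih =>
    rw [pow_succ', ← mul_assoc, ih (by omega)]
    simp only [mul_TFmat_apply]
    split_ifs with h1 h2 h3 h4 h5
    · simp only [add_assoc]; ring
    all_goals try omega
    · have : (⟨0, by omega⟩ : Fin k) = ⟨j + (n + 1) - k, by omega⟩ :=
        Fin.ext (by simp only; omega)
      rw [this]; ring
    · have : (⟨j + n - k + 1, by omega⟩ : Fin k) = ⟨j + (n + 1) - k, by omega⟩ :=
        Fin.ext (by simp only; omega)
      rw [this]; ring

lemma TFmat_pow_self (k : ℕ) : TFmat k ^ k = (-1 : ℂ) ^ (k + 1) • 1 := by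
  ext i j
  have := TFmat_pow_mul_apply le_rfl (1 : Matrix (Fin k) (Fin k) ℂ) i j
  rw [mul_one] at this
  rw [this, dif_neg (by omega)]
  simp [Matrix.one_apply, Fin.ext_iff]

lemma TFmat_mul_transpose (k : ℕ) : TFmat k * (TFmat k)ᵀ = 1 := by
  ext i j
  rw [TFmat_mul_apply, Matrix.one_apply]
  simp only [transpose_apply, TFmat, of_apply, Fin.ext_iff]
  grind

/-- The strictly triangular part of `Kk2mat`. -/
lemma Kk2mat_sub_one_apply {k : ℕ} (i j : Fin k) :
    (Kk2mat k - 1) i j =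
      if 1 ≤ (i : ℕ) ∧ (i : ℕ) < j ∧ (i : ℕ) + j = k then (k.choose (2 * i) : ℂ) else 0 := by
  simp only [Matrix.sub_apply, Matrix.one_apply, Kk2mat, of_apply, Fin.ext_iff]
  grind

/-- The off-diagonal part of `Kk3mat`. -/
lemma Kk3mat_sub_one_apply {k : ℕ} (i j : Fin k) :
    (Kk3mat k - 1) i j =
      if (i : ℕ) = 1 ∧ (j : ℕ) = 0 then -(k : ℂ)
      else if 2 ≤ (i : ℕ) ∧ (i : ℕ) < j ∧ (i : ℕ) + j = k + 1 then
        (k.choose (2 * i - 1) : ℂ) else 0 := by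
  have e : 2 * ((i : ℕ) + 1) - 3 = 2 * i - 1 := by omega
  simp only [Matrix.sub_apply, Matrix.one_apply, Kk3mat, of_apply, Fin.ext_iff, e]
  grind

lemma Kk2mat_sub_one_mul_self (k : ℕ) : (Kk2mat k - 1) * (Kk2mat k - 1) = 0 := by
  ext i j
  rw [Matrix.mul_apply]
  refine Finset.sum_eq_zero fun l _ => ?_
  simp only [Kk2mat_sub_one_apply]
  split_ifs <;> first | omega | simp

lemma Kk3mat_sub_one_mul_self (k : ℕ) : (Kk3mat k - 1) * (Kk3mat k - 1) = 0 := by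
  ext i j
  rw [Matrix.mul_apply]
  refine Finset.sum_eq_zero fun l _ => ?_
  simp only [Kk3mat_sub_one_apply]
  split_ifs <;> first | omega | simp

lemma mul_two_sub_eq_one {R : Type*} [Ring R] {a : R} (h : (a - 1) * (a - 1) = 0) :
    a * (2 - a) = 1 := by
  have : a * (2 - a) = 1 - (a - 1) * (a - 1) := by noncomm_ring
  rw [this, h, sub_zero]

lemma semiconj_two_sub {R : Type*} [Ring R] {f a b : R} (h : f * (a - 1) = -((b - 1) * f)) :
    f * (2 - a) = b * f := by
  have : f * (2 - a) = f - f * (a - 1) := by noncomm_ring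
  rw [this, h]
  noncomm_ring

lemma TFmat_pow_mul_Kk2mat_even {m : ℕ} :
    TFmat (2 * m) ^ m * (2 - Kk2mat (2 * m)) = (Kk2mat (2 * m))ᵀ * TFmat (2 * m) ^ m := by
  refine semiconj_two_sub ?_
  rw [← transpose_one, ← transpose_sub]
  ext i j
  rw [Matrix.neg_apply, TFmat_pow_mul_apply (by omega), mul_TFmat_pow_apply (by omega)]
  simp only [transpose_apply, transpose_one, Kk2mat_sub_one_apply]
  split_ifs <;> try first | omega | simp only [mul_zero, neg_zero]
  · rw [Nat.choose_symm_of_eq_add (show 2 * m = 2 * (i - m) + (2 * (j + m - 2 * m)) by omega)]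
    ring

lemma TFmat_pow_mul_Kk3mat_even {m : ℕ} (hm : 2 ≤ m) :
    TFmat (2 * m) ^ m * (2 - Kk3mat (2 * m)) = (Kk3mat (2 * m))ᵀ * TFmat (2 * m) ^ m := by
  refine semiconj_two_sub ?_
  rw [← transpose_one, ← transpose_sub]
  ext i j
  rw [Matrix.neg_apply, TFmat_pow_mul_apply (by omega), mul_TFmat_pow_apply (by omega)]
  simp only [transpose_apply, transpose_one, Kk3mat_sub_one_apply]
  split_ifs <;> try first | omega | simp only [mul_zero, neg_zero]
  · rw [Nat.choose_symm_of_eq_add (show 2 * m = 2 * (j + m) - 1 + 1 by omega), Nat.choose_one_right]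
    ring
  · rw [Nat.choose_symm_of_eq_add
      (show 2 * m = 2 * (i - m) - 1 + (2 * (j + m - 2 * m) - 1) by omega)]
    ring
  · rw [Nat.choose_symm_of_eq_add
      (show 2 * m = 2 * (i + 2 * m - m) - 1 + 1 by omega), Nat.choose_one_right]
    ring

lemma TFmat_pow_mul_Kk3mat_odd {m : ℕ} (hm : 1 ≤ m) :
    TFmat (2 * m + 1) ^ m * (2 - Kk3mat (2 * m + 1)) =
      (Kk2mat (2 * m + 1))ᵀ * TFmat (2 * m + 1) ^ m := by
  refine semiconj_two_sub ?_
  rw [← transpose_one, ← transpose_sub]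
  ext i j
  rw [Matrix.neg_apply, TFmat_pow_mul_apply (by omega), mul_TFmat_pow_apply (by omega)]
  simp only [transpose_apply, transpose_one, Kk2mat_sub_one_apply, Kk3mat_sub_one_apply]
  split_ifs <;> try first | omega | simp only [mul_zero, neg_zero]
  · rw [Nat.choose_symm_of_eq_add (show 2 * m + 1 = 2 * (j + m) + 1 by omega), Nat.choose_one_right]
    ring
  · rw [Nat.choose_symm_of_eq_add
      (show 2 * m + 1 = 2 * (i - m) - 1 + (2 * (j + m - (2 * m + 1))) by omega)]
    ring

lemma TFmat_pow_mul_Kk2mat_odd {m : ℕ} (hm : 1 ≤ m) :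
    TFmat (2 * m + 1) ^ (m + 1) * (2 - Kk2mat (2 * m + 1)) =
      (Kk3mat (2 * m + 1))ᵀ * TFmat (2 * m + 1) ^ (m + 1) := by
  refine semiconj_two_sub ?_
  rw [← transpose_one, ← transpose_sub]
  ext i j
  rw [Matrix.neg_apply, TFmat_pow_mul_apply (by omega), mul_TFmat_pow_apply (by omega)]
  simp only [transpose_apply, transpose_one, Kk2mat_sub_one_apply, Kk3mat_sub_one_apply]
  split_ifs <;> try first | omega | simp only [mul_zero, neg_zero]
  · rw [Nat.choose_symm_of_eq_add
      (show 2 * m + 1 = 2 * (i - (m + 1)) + (2 * (j + (m + 1) - (2 * m + 1)) - 1) by omega)]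
    ring
  · rw [Nat.choose_symm_of_eq_add
      (show 2 * m + 1 = 2 * (i + (2 * m + 1) - (m + 1)) + 1 by omega), Nat.choose_one_right]
    ring

lemma TFmat_inv (k : ℕ) : (TFmat k)⁻¹ = (TFmat k)ᵀ :=
  Matrix.inv_eq_right_inv (TFmat_mul_transpose k)

lemma Tmonodromy_eq (k : ℕ) :
    Tmonodromy k = (2 - Kk2mat k) * (2 - Kk3mat k) * TFmat k := by
  refine Matrix.inv_eq_right_inv ?_
  have hA := mul_two_sub_eq_one (Kk3mat_sub_one_mul_self k)
  have hB := mul_two_sub_eq_one (Kk2mat_sub_one_mul_self k)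
  have hF := mul_eq_one_comm.mp (TFmat_mul_transpose k)
  rw [TFmat_inv]
  calc _ = (TFmat k)ᵀ * (Kk3mat k * (Kk2mat k * (2 - Kk2mat k)) * (2 - Kk3mat k)) * TFmat k := by
        simp only [mul_assoc]
    _ = 1 := by rw [hB, mul_one, hA, mul_one, hF]

lemma isUnit_Tmonodromy_inv_factor (k : ℕ) :
    IsUnit ((TFmat k)ᵀ * Kk3mat k * Kk2mat k) := by
  have hA := IsUnit.of_mul_eq_one _ (mul_two_sub_eq_one (Kk3mat_sub_one_mul_self k))
  have hB := IsUnit.of_mul_eq_one _ (mul_two_sub_eq_one (Kk2mat_sub_one_mul_self k))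
  have hF := IsUnit.of_mul_eq_one _ (mul_eq_one_comm.mp (TFmat_mul_transpose k))
  exact (hF.mul hA).mul hB

lemma Tmonodromy_inv (k : ℕ) :
    (Tmonodromy k)⁻¹ = (TFmat k)ᵀ * Kk3mat k * Kk2mat k := by
  rw [Tmonodromy, TFmat_inv]
  exact Matrix.nonsing_inv_nonsing_inv _
    ((Matrix.isUnit_iff_isUnit_det _).mp (isUnit_Tmonodromy_inv_factor _))

lemma isUnit_Tmonodromy_inv (k : ℕ) : IsUnit (Tmonodromy k)⁻¹ :=
  Tmonodromy_inv _ ▸ isUnit_Tmonodromy_inv_factor _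

lemma Tmonodromy_inv_pow_mul_pow (k : ℕ) (n : ℕ) :
    (Tmonodromy k)⁻¹ ^ n * Tmonodromy k ^ n = 1 := by
  have h : (Tmonodromy k)⁻¹ * Tmonodromy k = 1 :=
    Matrix.nonsing_inv_mul _ ((Matrix.isUnit_iff_isUnit_det _).mp
      (Matrix.isUnit_nonsing_inv_iff.mp (isUnit_Tmonodromy_inv _)))
  have hc : Commute (Tmonodromy k)⁻¹ (Tmonodromy k) := h.trans (mul_eq_one_comm.mp h).symm
  rw [← hc.mul_pow, h, one_pow]

lemma Tmonodromy_inv_transpose (k : ℕ) :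
    (Tmonodromy k)⁻¹ᵀ = (Kk2mat k)ᵀ * (Kk3mat k)ᵀ * TFmat k := by
  rw [Tmonodromy_inv _]
  simp [mul_assoc]

lemma isUnit_Smat (k : ℕ) : IsUnit (Smat k) := by
  have hB := IsUnit.of_mul_eq_one _ (mul_two_sub_eq_one (Kk2mat_sub_one_mul_self k))
  have hF := IsUnit.of_mul_eq_one _ (TFmat_mul_transpose k)
  have hT := isUnit_Tmonodromy_inv k
  rw [Smat]
  split_ifs
  · exact (hF.pow _).mul (hT.pow _)
  · exact ((hF.pow _).mul hB).mul (hT.pow _)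

/-- Complementary powers of `TFmat` agree up to sign and transposition. -/
lemma TFmat_pow_eq_smul_transpose_pow {k m n : ℕ} (h : m + n = k) :
    TFmat k ^ m = (-1 : ℂ) ^ (k + 1) • (TFmat k)ᵀ ^ n := by
  have hF := TFmat_mul_transpose k
  have hc : Commute (TFmat k) (TFmat k)ᵀ := hF.trans (mul_eq_one_comm.mp hF).symm
  calc TFmat k ^ m = TFmat k ^ m * (TFmat k ^ n * (TFmat k)ᵀ ^ n) := by
        rw [← hc.mul_pow, hF, one_pow, mul_one]
    _ = _ := by rw [← mul_assoc, ← pow_add, h, TFmat_pow_self, smul_mul_assoc, one_mul]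

lemma Smat_mul_Tmonodromy_pow_even {m : ℕ} (hm : 2 ≤ m) :
    Smat (2 * m) * Tmonodromy (2 * m) ^ (2 * m) =
      (-1 : ℂ) ^ (2 * m + 1) • (Smat (2 * m))ᵀ := by
  have hs : SemiconjBy (TFmat (2 * m) ^ m) (Tmonodromy (2 * m)) (Tmonodromy (2 * m))⁻¹ᵀ := by
    rw [SemiconjBy, Tmonodromy_inv_transpose _, Tmonodromy_eq _, ← mul_assoc, ← mul_assoc,
      TFmat_pow_mul_Kk2mat_even, mul_assoc _ (TFmat (2 * m) ^ m), TFmat_pow_mul_Kk3mat_even hm]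
    simp only [mul_assoc, ← pow_succ, ← pow_succ']
  have hp := (hs.pow_right m).eq
  have hS : Smat (2 * m) = TFmat (2 * m) ^ m * (Tmonodromy (2 * m))⁻¹ ^ m := by
    simp [Smat]
  calc Smat (2 * m) * Tmonodromy (2 * m) ^ (2 * m)
      = TFmat (2 * m) ^ m * ((Tmonodromy (2 * m))⁻¹ ^ m * Tmonodromy (2 * m) ^ m)
          * Tmonodromy (2 * m) ^ m := by
        rw [hS, two_mul, pow_add]; simp only [mul_assoc]
    _ = (Tmonodromy (2 * m))⁻¹ᵀ ^ m * TFmat (2 * m) ^ m := by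
        rw [Tmonodromy_inv_pow_mul_pow, mul_one, hp]
    _ = (-1 : ℂ) ^ (2 * m + 1) • (Smat (2 * m))ᵀ := by
        rw [hS, transpose_mul, transpose_pow, transpose_pow,
          TFmat_pow_eq_smul_transpose_pow (two_mul m).symm, mul_smul_comm]

lemma Smat_mul_Tmonodromy_pow_odd {m : ℕ} (hm : 1 ≤ m) :
    Smat (2 * m + 1) * Tmonodromy (2 * m + 1) ^ (2 * m + 1) =
      (-1 : ℂ) ^ (2 * m + 1 + 1) • (Smat (2 * m + 1))ᵀ := by
  have hA := TFmat_pow_mul_Kk3mat_odd hm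
  have hB := TFmat_pow_mul_Kk2mat_odd hm
  have hBB := mul_two_sub_eq_one (Kk2mat_sub_one_mul_self (2 * m + 1))
  have hS : Smat (2 * m + 1) =
      TFmat (2 * m + 1) ^ m * Kk2mat (2 * m + 1) * (Tmonodromy (2 * m + 1))⁻¹ ^ m := by
    simp [Smat, Nat.add_mod]
  have hT := Tmonodromy_eq (2 * m + 1)
  have hM := Tmonodromy_inv_transpose (2 * m + 1)
  have hTT := Tmonodromy_inv_pow_mul_pow (2 * m + 1) m
  have hFF := TFmat_pow_eq_smul_transpose_pow (show (m + 1) + m = 2 * m + 1 by omega)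
  have hk' : 2 * m + 1 = m + 1 + m := by omega
  generalize 2 * m + 1 = k at *
  have hs : SemiconjBy ((Kk2mat k)ᵀ * TFmat k ^ (m + 1)) (Tmonodromy k) (Tmonodromy k)⁻¹ᵀ := by
    calc (Kk2mat k)ᵀ * TFmat k ^ (m + 1) * Tmonodromy k
        = (Kk2mat k)ᵀ * (TFmat k ^ (m + 1) * (2 - Kk2mat k)) * (2 - Kk3mat k) * TFmat k := by
          rw [hT]; simp only [mul_assoc]
      _ = (Kk2mat k)ᵀ * (Kk3mat k)ᵀ * TFmat k * (TFmat k ^ m * (2 - Kk3mat k)) * TFmat k := by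
          rw [hB, pow_succ']; simp only [mul_assoc]
      _ = _ := by rw [hA, hM, pow_succ]; simp only [mul_assoc]
  have hp := (hs.pow_right m).eq
  have hBT : Kk2mat k * Tmonodromy k = (2 - Kk3mat k) * TFmat k := by
    rw [hT, ← mul_assoc, ← mul_assoc, hBB, one_mul]
  calc Smat k * Tmonodromy k ^ k
      = Smat k * Tmonodromy k ^ (m + 1 + m) := by rw [← hk']
    _ = TFmat k ^ m * Kk2mat k * ((Tmonodromy k)⁻¹ ^ m * Tmonodromy k ^ m)
          * (Tmonodromy k * Tmonodromy k ^ m) := by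
        rw [hS, ← pow_succ', add_comm (m + 1) m, pow_add]; simp only [mul_assoc]
    _ = TFmat k ^ m * (2 - Kk3mat k) * TFmat k * Tmonodromy k ^ m := by
        rw [hTT, mul_one, mul_assoc (TFmat k ^ m), ← mul_assoc (Kk2mat k), hBT]
        simp only [mul_assoc]
    _ = (Tmonodromy k)⁻¹ᵀ ^ m * ((Kk2mat k)ᵀ * TFmat k ^ (m + 1)) := by
        rw [hA, ← hp, pow_succ]; simp only [mul_assoc]
    _ = (-1 : ℂ) ^ (k + 1) • (Smat k)ᵀ := by
        rw [hS, hFF, mul_smul_comm, mul_smul_comm, transpose_mul, transpose_mul, transpose_pow,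
          transpose_pow]

/-- **Corollary 2 of the paper.** The Stokes matrix `S` of the quantum cohomology of
`CP^{k-1}` is invertible and the `k`-th power of the monodromy matrix `T` satisfies
`T^k = (-1)^{k-1} · S⁻¹ · Sᵀ`. -/
theorem monodromy_pow_eq_stokes (k : ℕ) (hk : 3 ≤ k) :
    IsUnit (Smat k) ∧
      (Tmonodromy k) ^ k = ((-1 : ℂ) ^ (k - 1)) • ((Smat k)⁻¹ * (Smat k)ᵀ) := by
  have hS := isUnit_Smat k
  refine ⟨hS, ?_⟩
  have key : Smat k * Tmonodromy k ^ k = (-1 : ℂ) ^ (k + 1) • (Smat k)ᵀ := by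
    obtain ⟨m, rfl | rfl⟩ := k.even_or_odd'
    · exact Smat_mul_Tmonodromy_pow_even (by omega)
    · exact Smat_mul_Tmonodromy_pow_odd (by omega)
  have hsign : (-1 : ℂ) ^ (k - 1) = (-1) ^ (k + 1) := by
    obtain ⟨n, rfl⟩ := Nat.exists_eq_add_of_le' (show 1 ≤ k by omega)
    simp [pow_succ]
  rw [hsign, ← mul_smul_comm, ← key,
    Matrix.nonsing_inv_mul_cancel_left _ _ ((Matrix.isUnit_iff_isUnit_det _).mp hS)]
end
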